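/- Binomial-type counting bound on quantized trajectories: let n, M ∈ ℕ, v₊ ∈ (0, 1/2), and consider the set 𝔅 of sequences w^n ∈ [nM]^n of the form w_t = ⌈ l(s, v, t)·nM ⌉ for some s ∈ [0,1] and v ∈ [−v₊, v₊], where l is the reflected-line trajectory. Then |𝔅| ≤ 2(nv₊ + 3)·n⁴·M². (One-dimensional case d = 1 of the paper's bound |𝔅_{n,M}| ≤ (2(nv₊+3)n⁴M²)^d.) -/

import Mathlib

/-- The reflected ("torus with reflection") location: reduce `s + t·v` mod 2 and fold. -/
noncomputable def reflectedLoc (s v t : ℝ) : ℝ :=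
  let r := 2 * Int.fract ((s + t * v) / 2)
  if r ≤ 1 then r else 2 - r

namespace QTraj

/-- face code of a real number relative to the integer grid -/
noncomputable def code (x : ℝ) : ℤ := ⌊x⌋ + ⌈x⌉

/-- scaled position at time `j+1` -/
def pos (j : ℕ) (p : ℝ × ℝ) : ℝ := p.1 + ((j : ℝ) + 1) * p.2

/-- code vector of the first `j` times -/
noncomputable def cd (j : ℕ) (p : ℝ × ℝ) : ℕ → ℤ := fun i => if i < j then code (pos i p) else 0

lemma code_mono {x y : ℝ} (h : x ≤ y) : code x ≤ code y :=
  add_le_add (Int.floor_mono h) (Int.ceil_mono h)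

lemma code_cases (x : ℝ) : (x = ⌊x⌋ ∧ code x = 2 * ⌊x⌋ ∧ ⌈x⌉ = ⌊x⌋) ∨
    ((⌊x⌋ : ℝ) < x ∧ code x = 2 * ⌊x⌋ + 1 ∧ ⌈x⌉ = ⌊x⌋ + 1) := by
  unfold code
  rcases eq_or_lt_of_le (Int.floor_le x) with h | h
  · left
    have h2 : ⌈x⌉ = ⌊x⌋ := by
      rw [Int.ceil_eq_iff]; constructor <;> linarith
    exact ⟨h.symm, by omega, h2⟩
  · right
    have h2 : ⌈x⌉ = ⌊x⌋ + 1 := by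
      rw [Int.ceil_eq_iff]; push_cast
      constructor
      · linarith
      · exact (Int.lt_floor_add_one x).le
    exact ⟨h, by omega, h2⟩

lemma code_eq_imp {x y : ℝ} (h : code x = code y) : ⌊x⌋ = ⌊y⌋ ∧ ⌈x⌉ = ⌈y⌉ := by
  rcases code_cases x with ⟨_, h1, h2⟩ | ⟨_, h1, h2⟩ <;>
  rcases code_cases y with ⟨_, h3, h4⟩ | ⟨_, h3, h4⟩ <;> omega

lemma pos_comb (j : ℕ) (p q : ℝ × ℝ) (a b : ℝ) :
    pos j (a • p + b • q) = a * pos j p + b * pos j q := by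
  simp [pos]; ring

lemma cd_succ (j : ℕ) (p : ℝ × ℝ) :
    cd (j + 1) p = Function.update (cd j p) j (code (pos j p)) := by
  funext i
  unfold cd
  by_cases h : i = j
  · subst h; simp
  · rw [Function.update_of_ne h]
    have : i < j + 1 ↔ i < j := by omega
    simp [this]

lemma cd_comb (j : ℕ) (p q : ℝ × ℝ) (h : cd j p = cd j q) (a b : ℝ) (ha : 0 ≤ a) (hb : 0 ≤ b)
    (hab : a + b = 1) : cd j (a • p + b • q) = cd j p := by
  funext i
  have hi := congrFun h i
  unfold cd at hi ⊢
  split_ifs with hij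
  · rw [if_pos hij, if_pos hij] at hi
    rw [pos_comb]
    have hb' : b = 1 - a := by linarith
    subst hb'
    rcases le_total (pos i p) (pos i q) with hl | hl
    · apply le_antisymm
      · rw [hi]; apply code_mono; nlinarith
      · apply code_mono; nlinarith
    · apply le_antisymm
      · apply code_mono; nlinarith
      · rw [hi]; apply code_mono; nlinarith
  · rfl

lemma encard_biUnion_le (K : Finset ℤ) (f : ℤ → Set (ℕ → ℤ)) :
    (⋃ k ∈ K, f k).encard ≤ ∑ k ∈ K, (f k).encard := by
  classical
  induction K using Finset.induction_on with
  | empty => simp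
  | insert a s ha ih =>
    rw [Finset.set_biUnion_insert, Finset.sum_insert ha]
    exact (Set.encard_union_le _ _).trans (by gcongr)

lemma step (j : ℕ) (X : Set (ℝ × ℝ)) (hX : Convex ℝ X) (K : Finset ℤ)
    (hK : ∀ p ∈ X, ∀ k : ℤ, pos j p = k → k ∈ K) :
    (cd (j + 1) '' X).encard ≤ (cd j '' X).encard +
      ∑ k ∈ K, 2 * (cd j '' (X ∩ {p | pos j p = (k : ℝ)})).encard := by
  set A : Set (ℕ → ℤ) := {b | ∃ p ∈ X, b = cd (j + 1) p ∧
    ∀ p' ∈ X, cd j p' = cd j p → code (pos j p) ≤ code (pos j p')} with hA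
  have hsub : cd (j + 1) '' X ⊆ A ∪ ⋃ k ∈ K,
      ((fun a => Function.update a j (2 * k)) '' (cd j '' (X ∩ {p | pos j p = (k : ℝ)})) ∪
       (fun a => Function.update a j (2 * k + 1)) ''
        (cd j '' (X ∩ {p | pos j p = (k : ℝ)}))) := by
    rintro _ ⟨p, hp, rfl⟩
    by_cases hmin : ∀ p' ∈ X, cd j p' = cd j p → code (pos j p) ≤ code (pos j p')
    · exact Or.inl ⟨p, hp, rfl, hmin⟩
    right
    push Not at hmin
    obtain ⟨p', hp', hcd, hlt⟩ := hmin
    simp only [Set.mem_iUnion]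
    rcases code_cases (pos j p) with ⟨h1, h2, -⟩ | ⟨h1, h2, -⟩
    · refine ⟨⌊pos j p⌋, hK p hp _ h1, Or.inl ⟨cd j p, ⟨p, ⟨hp, h1⟩, rfl⟩, ?_⟩⟩
      rw [cd_succ, h2]
    · have hle : pos j p' ≤ ⌊pos j p⌋ := by
        by_contra hc
        push Not at hc
        have h3 : ⌊pos j p⌋ ≤ ⌊pos j p'⌋ := Int.le_floor.mpr hc.le
        have h4 : ⌊pos j p⌋ < ⌈pos j p'⌉ := Int.lt_ceil.mpr hc
        unfold code at h2 hlt
        omega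
      set k := ⌊pos j p⌋ with hk
      set D := pos j p - pos j p' with hD
      have hDpos : 0 < D := by linarith
      have ha : 0 ≤ ((k : ℝ) - pos j p') / D := div_nonneg (by linarith) hDpos.le
      have hb : 0 ≤ (pos j p - (k : ℝ)) / D := div_nonneg (by linarith) hDpos.le
      have hab : ((k : ℝ) - pos j p') / D + (pos j p - (k : ℝ)) / D = 1 := by
        field_simp; rw [hD]; ring
      have hq := hX hp hp' ha hb hab
      have hqc := cd_comb j p p' hcd.symm _ _ ha hb hab
      have hqp : pos j ((((k : ℝ) - pos j p') / D) • p + ((pos j p - (k : ℝ)) / D) • p') = k := by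
        rw [pos_comb]; field_simp; rw [hD]; ring
      refine ⟨k, hK _ hq _ hqp, Or.inr ⟨cd j p, ⟨_, ⟨hq, hqp⟩, hqc⟩, ?_⟩⟩
      rw [cd_succ, h2]
  have hAcard : A.encard ≤ (cd j '' X).encard := by
    have hinj : Set.InjOn (fun b : ℕ → ℤ => Function.update b j 0) A := by
      rintro _ ⟨p, hp, rfl, hm⟩ _ ⟨q, hq, rfl, hm'⟩ he
      have hup : ∀ r, Function.update (cd (j + 1) r) j 0 = cd j r := by
        intro r
        rw [cd_succ, Function.update_idem]
        have : (0 : ℤ) = cd j r j := by simp [cd]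
        rw [this, Function.update_eq_self]
      simp only [hup] at he
      rw [cd_succ, cd_succ, he, le_antisymm (hm q hq he.symm) (hm' p hp he)]
    rw [← hinj.encard_image]
    apply Set.encard_le_encard
    rintro _ ⟨_, ⟨p, hp, rfl, -⟩, rfl⟩
    refine ⟨p, hp, ?_⟩
    simp only
    rw [cd_succ, Function.update_idem]
    have : (0 : ℤ) = cd j p j := by simp [cd]
    rw [this, Function.update_eq_self]
  refine (Set.encard_le_encard hsub).trans ((Set.encard_union_le _ _).trans ?_)
  refine add_le_add hAcard ((encard_biUnion_le _ _).trans (Finset.sum_le_sum fun k _ => ?_))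
  refine (Set.encard_union_le _ _).trans ?_
  rw [two_mul (Set.encard _)]
  exact add_le_add (Set.encard_image_le _ _) (Set.encard_image_le _ _)

lemma iter (X : Set (ℝ × ℝ)) (hX : Convex ℝ X) (K : ℕ → Finset ℤ)
    (hK : ∀ j, ∀ p ∈ X, ∀ k : ℤ, pos j p = k → k ∈ K j) (n : ℕ) :
    (cd n '' X).encard ≤ (cd 0 '' X).encard +
      ∑ j ∈ Finset.range n, ∑ k ∈ K j,
        2 * (cd j '' (X ∩ {p | pos j p = (k : ℝ)})).encard := by
  induction n with
  | zero => simp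
  | succ n ih =>
    rw [Finset.sum_range_succ, ← add_assoc]
    exact (step n X hX (K n) (hK n)).trans (by gcongr)

lemma cd_zero_le (X : Set (ℝ × ℝ)) : (cd 0 '' X).encard ≤ 1 := by
  rw [Set.encard_le_one_iff]
  rintro _ _ ⟨p, _, rfl⟩ ⟨q, _, rfl⟩
  funext i; simp [cd]

lemma convex_slice (X : Set (ℝ × ℝ)) (hX : Convex ℝ X) (j : ℕ) (k : ℝ) :
    Convex ℝ (X ∩ {p | pos j p = k}) := by
  rintro p ⟨hp, hpk⟩ q ⟨hq, hqk⟩ a b ha hb hab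
  refine ⟨hX hp hq ha hb hab, ?_⟩
  simp only [Set.mem_ofPred_eq] at *
  rw [pos_comb, hpk, hqk, ← add_mul, hab, one_mul]

open Classical in
/-- number of grid crossings -/
lemma main_nat (X : Set (ℝ × ℝ)) (hX : Convex ℝ X) (K : ℕ → Finset ℤ)
    (hK : ∀ j, ∀ p ∈ X, ∀ k : ℤ, pos j p = k → k ∈ K j) (n : ℕ) :
    (cd n '' X).encard ≤ ((1 + ∑ j ∈ Finset.range n, (2 * (K j).card +
      ∑ i ∈ Finset.range j, 4 * ((K j ×ˢ K i).filter (fun km : ℤ × ℤ =>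
        ∃ p ∈ X, pos j p = (km.1 : ℝ) ∧ pos i p = (km.2 : ℝ))).card) : ℕ) : ℕ∞) := by
  refine (iter X hX K hK n).trans ?_
  push_cast
  refine add_le_add (cd_zero_le X) (Finset.sum_le_sum fun j _ => ?_)
  have h1 : ∀ k ∈ K j, 2 * (cd j '' (X ∩ {p | pos j p = (k : ℝ)})).encard ≤
      2 + ∑ i ∈ Finset.range j, ∑ m ∈ K i,
        (if (∃ p ∈ X, pos j p = (k : ℝ) ∧ pos i p = (m : ℝ)) then (4 : ℕ∞) else 0) := by
    intro k _
    have h2 := iter (X ∩ {p | pos j p = (k : ℝ)}) (convex_slice X hX j k) K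
      (fun j p hp => hK j p hp.1) j
    have h3 : (cd j '' (X ∩ {p | pos j p = (k : ℝ)})).encard ≤
       1 + ∑ i ∈ Finset.range j, ∑ m ∈ K i,
        (if (∃ p ∈ X, pos j p = (k : ℝ) ∧ pos i p = (m : ℝ)) then (2 : ℕ∞) else 0) := by
      refine h2.trans (add_le_add (cd_zero_le _) (Finset.sum_le_sum fun i hi =>
        Finset.sum_le_sum fun m _ => ?_))
      have hij : i < j := Finset.mem_range.mp hi
      split_ifs with hex
      · have : (cd i '' (X ∩ {p | pos j p = (k : ℝ)} ∩ {p | pos i p = (m : ℝ)})).encard ≤ 1 := by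
          rw [Set.encard_le_one_iff]
          rintro _ _ ⟨p, ⟨⟨_, hp1⟩, hp2⟩, rfl⟩ ⟨q, ⟨⟨_, hq1⟩, hq2⟩, rfl⟩
          have : p = q := by
            simp only [Set.mem_ofPred_eq, pos] at hp1 hp2 hq1 hq2
            have hne : ((j : ℝ) - i) ≠ 0 := by
              have : (i : ℝ) < j := by exact_mod_cast hij
              linarith
            have h5 : p.2 = q.2 := by
              apply mul_left_cancel₀ hne
              linarith
            refine Prod.ext ?_ h5
            rw [h5] at hp1
            linarith
          rw [this]
        calc _ ≤ 2 * (1 : ℕ∞) := by gcongr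
          _ = 2 := by norm_num
      · have : X ∩ {p | pos j p = (k : ℝ)} ∩ {p | pos i p = (m : ℝ)} = ∅ := by
          ext p
          simp only [Set.mem_inter_iff, Set.mem_ofPred_eq, Set.mem_empty_iff_false, iff_false]
          rintro ⟨⟨h, h'⟩, h''⟩
          exact hex ⟨p, h, h', h''⟩
        rw [this]; simp
    calc _ ≤ 2 * (1 + ∑ i ∈ Finset.range j, ∑ m ∈ K i,
        (if (∃ p ∈ X, pos j p = (k : ℝ) ∧ pos i p = (m : ℝ)) then (2 : ℕ∞) else 0)) := by gcongr
      _ = _ := by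
        rw [mul_add, Finset.mul_sum, mul_one]
        congr 1
        refine Finset.sum_congr rfl fun i _ => ?_
        rw [Finset.mul_sum]
        refine Finset.sum_congr rfl fun m _ => ?_
        split_ifs <;> norm_num
  refine (Finset.sum_le_sum h1).trans (le_of_eq ?_)
  rw [Finset.sum_add_distrib, Finset.sum_comm]
  congr 1
  · simp [mul_comm]
  · refine Finset.sum_congr rfl fun i _ => ?_
    rw [Finset.card_filter, Finset.sum_product]
    push_cast
    rw [Finset.mul_sum]
    refine Finset.sum_congr rfl fun k _ => ?_
    rw [Finset.mul_sum]
    refine Finset.sum_congr rfl fun m _ => ?_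
    split_ifs <;> simp

lemma card_Icc_le (a b : ℝ) (h : a ≤ b + 1) : ((Finset.Icc ⌈a⌉ ⌊b⌋).card : ℝ) ≤ b - a + 1 := by
  rw [Int.card_Icc]
  rcases le_total 0 (⌊b⌋ + 1 - ⌈a⌉) with h0 | h0
  · have : (((⌊b⌋ + 1 - ⌈a⌉).toNat : ℤ) : ℝ) = ((⌊b⌋ + 1 - ⌈a⌉ : ℤ) : ℝ) := by
      rw [Int.toNat_of_nonneg h0]
    rw [Int.cast_natCast] at this
    rw [this]; push_cast
    linarith [Int.floor_le b, Int.le_ceil a]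
  · rw [Int.toNat_of_nonpos h0]; push_cast; linarith

/-- the scaled parameter rectangle -/
def R (N U : ℝ) : Set (ℝ × ℝ) := Set.Icc 0 N ×ˢ Set.Icc (-U) U

/-- grid values reachable at time `j+1` -/
noncomputable def KK (N U : ℝ) (j : ℕ) : Finset ℤ :=
  Finset.Icc ⌈-(((j : ℝ) + 1) * U)⌉ ⌊N + ((j : ℝ) + 1) * U⌋

open Classical in
lemma pair_count (N U : ℝ) (hN : 0 ≤ N) (hU : 0 ≤ U) (i j : ℕ) (hij : i < j) :
    ((((KK N U j ×ˢ KK N U i).filter (fun km : ℤ × ℤ =>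
        ∃ p ∈ R N U, pos j p = (km.1 : ℝ) ∧ pos i p = (km.2 : ℝ))).card : ℕ) : ℝ) ≤
      (N + 1) * (2 * ((j : ℝ) - i) * U + 1) := by
  set P := (KK N U j ×ˢ KK N U i).filter (fun km : ℤ × ℤ =>
        ∃ p ∈ R N U, pos j p = (km.1 : ℝ) ∧ pos i p = (km.2 : ℝ)) with hP
  have hq : (0 : ℝ) < (j : ℝ) - i := by
    have : (i : ℝ) < j := by exact_mod_cast hij
    linarith
  set q : ℝ := (j : ℝ) - i with hqdef
  have key : ∀ km ∈ P, ∃ p ∈ R N U, pos j p = (km.1 : ℝ) ∧ pos i p = (km.2 : ℝ) :=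
    fun km h => (Finset.mem_filter.mp h).2
  set T := Finset.Icc ⌈-(q * U)⌉ ⌊q * U⌋ with hT
  have hmaps : ∀ km ∈ P, km.1 - km.2 ∈ T := by
    intro km h
    obtain ⟨p, ⟨_, hp2⟩, h1, h2⟩ := key km h
    unfold pos at h1 h2
    have hd : ((km.1 - km.2 : ℤ) : ℝ) = q * p.2 := by push_cast; rw [hqdef]; linarith
    rw [hT, Finset.mem_Icc, Int.ceil_le, Int.le_floor, hd]
    constructor <;> nlinarith [hp2.1, hp2.2]
  have hfib : ∀ d ∈ T, ((P.filter (fun km => km.1 - km.2 = d)).card : ℝ) ≤ N + 1 := by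
    intro d _
    set α : ℝ := ((j : ℝ) + 1) * (d / q) with hα
    have hle : (P.filter (fun km => km.1 - km.2 = d)).card ≤
        (Finset.Icc ⌈α⌉ ⌊N + α⌋).card := by
      apply Finset.card_le_card_of_injOn (fun km => km.1)
      · intro km hkm
        have hkm' := Finset.mem_filter.mp hkm
        obtain ⟨p, ⟨hp1, hp2⟩, h1, h2⟩ := key km hkm'.1
        unfold pos at h1 h2
        have hd : (d : ℝ) = q * p.2 := by
          rw [← hkm'.2]; push_cast; rw [hqdef]; linarith
        have hu : (d : ℝ) / q = p.2 := by rw [hd]; field_simp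
        rw [hu] at hα
        simp only [Finset.coe_Icc, Set.mem_Icc, Int.ceil_le, Int.le_floor]
        constructor <;> linarith [hp1.1, hp1.2]
      · intro a ha b hb hab
        have ha' := (Finset.mem_filter.mp ha).2
        have hb' := (Finset.mem_filter.mp hb).2
        simp only at hab
        exact Prod.ext hab (by omega)
    have h3 := card_Icc_le α (N + α) (by linarith)
    have h4 : ((P.filter (fun km => km.1 - km.2 = d)).card : ℝ) ≤
        ((Finset.Icc ⌈α⌉ ⌊N + α⌋).card : ℝ) := by exact_mod_cast hle
    linarith
  rw [Finset.card_eq_sum_card_fiberwise (f := fun km : ℤ × ℤ => km.1 - km.2) (t := T) hmaps]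
  push_cast
  refine (Finset.sum_le_sum hfib).trans ?_
  rw [Finset.sum_const, nsmul_eq_mul, mul_comm]
  have hTc : (T.card : ℝ) ≤ q * U - -(q * U) + 1 := card_Icc_le _ _ (by nlinarith)
  apply mul_le_mul_of_nonneg_left _ (by linarith)
  linarith

lemma inner_sum (c U : ℝ) (j : ℕ) :
    ∑ i ∈ Finset.range j, (c * (2 * ((j : ℝ) - i) * U + 1)) = c * ((j : ℝ) * (j + 1) * U + j) := by
  have h : ∀ m : ℕ, ∀ x : ℝ, ∑ i ∈ Finset.range m, (c * (2 * (x - i) * U + 1)) =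
      c * ((2 * x * m - m * (m - 1)) * U + m) := by
    intro m x
    induction m with
    | zero => simp
    | succ m ih => rw [Finset.sum_range_succ, ih]; push_cast; ring
  rw [h]; ring

lemma outer_sum (N U : ℝ) (n : ℕ) :
    ∑ j ∈ Finset.range n, (2 * (N + 2 * ((j : ℝ) + 1) * U + 1) +
      4 * ((N + 1) * ((j : ℝ) * (j + 1) * U + j))) =
     2 * n * (N + 1) + 2 * n * (n + 1) * U + (N + 1) * (4 / 3 * U * (n ^ 3 - n) + 2 * n * (n - 1)) := by
  induction n with
  | zero => simp
  | succ m ih => rw [Finset.sum_range_succ, ih]; push_cast; ring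

lemma count_R (N U : ℝ) (hN : 0 ≤ N) (hU : 0 ≤ U) (n : ℕ) :
    (cd n '' R N U).Finite ∧ ((cd n '' R N U).ncard : ℝ) ≤ 1 + (2 * n * (N + 1) +
      2 * n * (n + 1) * U + (N + 1) * (4 / 3 * U * (n ^ 3 - n) + 2 * n * (n - 1))) := by
  classical
  have h := main_nat (R N U) ((convex_Icc _ _).prod (convex_Icc _ _)) (KK N U) (by
    rintro j p ⟨hp1, hp2⟩ k hk
    unfold pos at hk
    have hj : (0 : ℝ) ≤ (j : ℝ) + 1 := by positivity
    rw [KK, Finset.mem_Icc, Int.ceil_le, Int.le_floor, ← hk]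
    constructor <;> nlinarith [hp1.1, hp1.2, mul_le_mul_of_nonneg_left hp2.1 hj,
      mul_le_mul_of_nonneg_left hp2.2 hj]) n
  rw [Set.encard_le_coe_iff_finite_ncard_le] at h
  refine ⟨h.1, (Nat.cast_le (α := ℝ).mpr h.2).trans ?_⟩
  push_cast
  rw [← outer_sum]
  gcongr with j hj
  · have := card_Icc_le (-(((j : ℝ) + 1) * U)) (N + ((j : ℝ) + 1) * U) (by nlinarith)
    unfold KK
    linarith
  · rw [← inner_sum, Finset.mul_sum]
    apply Finset.sum_le_sum
    intro i hi
    gcongr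
    convert pair_count N U hN hU i j (Finset.mem_range.mp hi)

/-- quantized reflected position as a function of the scaled position -/
noncomputable def hq (N : ℕ) (y : ℝ) : ℤ := ⌈reflectedLoc (y / N) 0 0 * N⌉

lemma hq_eq (N : ℕ) (hN : 0 < N) (y : ℝ) : hq N y =
    if ⌈y⌉ - 2 * N * (⌊y⌋ / ((2 * N : ℕ) : ℤ)) ≤ N then ⌈y⌉ - 2 * N * (⌊y⌋ / ((2 * N : ℕ) : ℤ))
    else 2 * N - (⌊y⌋ - 2 * N * (⌊y⌋ / ((2 * N : ℕ) : ℤ))) := by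
  have hN' : (0 : ℝ) < N := by exact_mod_cast hN
  set z : ℤ := ⌊y⌋ / ((2 * N : ℕ) : ℤ) with hz
  have hz' : ⌊(y / N + 0 * 0) / 2⌋ = z := by
    rw [hz, ← Int.floor_div_natCast]
    congr 1
    push_cast; field_simp; ring
  have hr : 2 * Int.fract ((y / N + 0 * 0) / 2) = (y - ((2 * N * z : ℤ) : ℝ)) / N := by
    rw [← Int.self_sub_floor, hz']; push_cast; field_simp; ring
  unfold hq reflectedLoc
  simp only [hr]
  have hiff : ((y - ((2 * N * z : ℤ) : ℝ)) / N ≤ 1) ↔ ⌈y⌉ - 2 * N * z ≤ N := by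
    rw [div_le_one hN', ← Int.ceil_sub_intCast, Int.ceil_le]; simp
  by_cases hc : ⌈y⌉ - 2 * N * z ≤ N
  · rw [if_pos (hiff.mpr hc), if_pos hc, div_mul_cancel₀ _ hN'.ne', Int.ceil_sub_intCast]
  · rw [if_neg (fun h => hc (hiff.mp h)), if_neg hc]
    have : (2 - (y - ((2 * N * z : ℤ) : ℝ)) / N) * N = -y + ((2 * N + 2 * N * z : ℤ) : ℝ) := by
      push_cast; field_simp; ring
    rw [this, Int.ceil_add_intCast, Int.ceil_neg]; ring

lemma final_ineq (n M v : ℝ) (hn : n = 1 ∨ 2 ≤ n) (hM : 1 ≤ M) (h0 : 0 < v) (h1 : v < 1 / 2) :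
    1 + (2 * n * (n * M + 1) + 2 * n * (n + 1) * (n * M * v) +
      (n * M + 1) * (4 / 3 * (n * M * v) * (n ^ 3 - n) + 2 * n * (n - 1))) ≤
    2 * (n * v + 3) * n ^ 4 * M ^ 2 := by
  rcases hn with rfl | hn
  · nlinarith [mul_nonneg (sub_nonneg.mpr hM) h0.le, mul_nonneg (sub_nonneg.mpr hM)
      (sub_nonneg.mpr hM), mul_pos h0 h0, mul_nonneg (mul_nonneg (sub_nonneg.mpr hM) (sub_nonneg.mpr hM)) h0.le, mul_nonneg (sub_nonneg.mpr hM) (sub_nonneg.mpr h1.le)]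
  · set N := n * M with hN
    have hNn : n ≤ N := by nlinarith
    have e : 2 * (n * v + 3) * n ^ 4 * M ^ 2 = 2 * n ^ 3 * v * N ^ 2 + 6 * n ^ 2 * N ^ 2 := by
      rw [hN]; ring
    rw [e]
    have hNp : 0 < N := by linarith
    have a1 : (N + 1) * (4 / 3 * (N * v) * (n ^ 3 - n)) ≤ (3 / 2 * N) * (4 / 3 * (N * v) * n ^ 3) := by
      have : 0 ≤ n ^ 3 - n := by nlinarith [sq_nonneg n]
      gcongr
      · linarith
      · linarith
    have a2 : 2 * n * (n + 1) * (N * v) ≤ 2 * n ^ 2 * N := by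
      have : 2 * n * (n + 1) * (N * v) ≤ 2 * n * (n + n) * (N * (1 / 2)) := by
        gcongr
        linarith
      linarith
    have a3 : 2 * n ^ 2 * (N + 1) ≤ 3 * n ^ 2 * N := by
      have := mul_le_mul_of_nonneg_left (show N + 1 ≤ 3 / 2 * N by linarith) (show 0 ≤ 2 * n ^ 2 by positivity)
      linarith
    have a4 : 12 * (n ^ 2 * N) ≤ 6 * n ^ 2 * N ^ 2 := by
      have := mul_le_mul_of_nonneg_left (show 2 ≤ N by linarith) (show 0 ≤ 6 * (n ^ 2 * N) by positivity)
      linarith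
    have a5 : 1 ≤ n ^ 2 * N := by
      have : 1 ≤ n ^ 2 := by nlinarith
      nlinarith
    linarith

end QTraj

/-- Counting bound on quantized trajectories (one-dimensional case):
the number of quantized trajectories `(⌈l(s,v,t)·nM⌉)_{t=1}^n` generated by some
`s ∈ [0,1]`, `v ∈ [-v₊,v₊]` is at most `2(nv₊+3)n⁴M²`. -/
theorem quantized_trajectory_count (n M : ℕ) (hn : 0 < n) (hM : 0 < M)
    (vplus : ℝ) (hv : vplus ∈ Set.Ioo (0 : ℝ) (1 / 2)) :
    ((({w : Fin n → ℤ | ∃ s ∈ Set.Icc (0 : ℝ) 1, ∃ v ∈ Set.Icc (-vplus) vplus,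
        ∀ t : Fin n, w t = ⌈reflectedLoc s v ((t : ℝ) + 1) * ((n : ℝ) * M)⌉}).ncard : ℝ))
      ≤ 2 * ((n : ℝ) * vplus + 3) * (n : ℝ) ^ 4 * (M : ℝ) ^ 2 := by
  have hNn : 0 < n * M := Nat.mul_pos hn hM
  have hNpos : (0 : ℝ) < (n : ℝ) * M := by exact_mod_cast hNn
  obtain ⟨hfin, hcard⟩ := QTraj.count_R ((n : ℝ) * M) ((n : ℝ) * M * vplus) hNpos.le
    (mul_nonneg hNpos.le hv.1.le) n
  have hfac : Function.FactorsThrough (QTraj.hq (n * M)) QTraj.code := by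
    intro x y hxy
    obtain ⟨h1, h2⟩ := QTraj.code_eq_imp hxy
    rw [QTraj.hq_eq _ hNn, QTraj.hq_eq _ hNn, h1, h2]
  set g : ℤ → ℤ := Function.extend QTraj.code (QTraj.hq (n * M)) 0 with hg
  have hgc : ∀ y, g (QTraj.code y) = QTraj.hq (n * M) y := fun y => hfac.extend_apply 0 y
  have hsub : {w : Fin n → ℤ | ∃ s ∈ Set.Icc (0 : ℝ) 1, ∃ v ∈ Set.Icc (-vplus) vplus,
        ∀ t : Fin n, w t = ⌈reflectedLoc s v ((t : ℝ) + 1) * ((n : ℝ) * M)⌉} ⊆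
      (fun (a : ℕ → ℤ) (t : Fin n) => g (a t)) ''
        (QTraj.cd n '' QTraj.R ((n : ℝ) * M) ((n : ℝ) * M * vplus)) := by
    rintro w ⟨s, hs, v, hv', hw⟩
    refine ⟨_, ⟨((n : ℝ) * M * s, (n : ℝ) * M * v), ⟨⟨?_, ?_⟩, ⟨?_, ?_⟩⟩, rfl⟩, ?_⟩
    · exact mul_nonneg hNpos.le hs.1
    · simpa using mul_le_mul_of_nonneg_left hs.2 hNpos.le
    · simpa using mul_le_mul_of_nonneg_left hv'.1 hNpos.le
    · exact mul_le_mul_of_nonneg_left hv'.2 hNpos.le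
    · funext t
      have e : QTraj.pos t ((n : ℝ) * M * s, (n : ℝ) * M * v) / ((n : ℝ) * M) =
          s + ((t : ℝ) + 1) * v := by
        unfold QTraj.pos; field_simp
      simp only [QTraj.cd, t.isLt, if_true]
      rw [hgc, hw t, QTraj.hq]
      unfold reflectedLoc
      push_cast
      rw [e]
      simp
  have hle := (Set.ncard_le_ncard hsub (hfin.image _)).trans (Set.ncard_image_le hfin)
  refine (Nat.cast_le (α := ℝ).mpr hle).trans (hcard.trans ?_)
  refine QTraj.final_ineq n M vplus ?_ (by exact_mod_cast hM) hv.1 hv.2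
  rcases Nat.lt_or_ge 1 n with h | h
  · right; exact_mod_cast h
  · left
    have : n = 1 := by omega
    exact_mod_cast this
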